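/- Let p be a prime with p ≡ 3 (mod 4), let Q be the Paley core of order p, and let j_p denote the all-ones column vector of length p. Then the (p+1) × (p+1) block matrix M = [[Q + I, −j_p], [j_pᵀ, 1]] is a Hadamard matrix: all its entries lie in {1, −1} and M·Mᵀ = (p+1)·I_{p+1}. -/

import Mathlib

open Matrix

/-- Distinct translates of the quadratic character of a finite field of odd characteristic have
correlation `-1`. -/
lemma sum_quadraticChar_mul_quadraticChar_of_ne {F : Type*} [Field F] [Fintype F] [DecidableEq F]
    (hF : ringChar F ≠ 2) {x y : F} (hxy : x ≠ y) :
    ∑ z, quadraticChar F (x - z) * quadraticChar F (y - z) = -1 := by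
  have hd : x - y ≠ 0 := sub_ne_zero.mpr hxy
  have hχ := quadraticChar_ne_one hF
  have hJ := jacobiSum_nontrivial_inv hχ
  rw [(quadraticChar_isQuadratic F).inv, jacobiSum] at hJ
  calc ∑ z, quadraticChar F (x - z) * quadraticChar F (y - z)
      = ∑ u, quadraticChar F ((x - y) * u) * quadraticChar F (y - x + (x - y) * u) := by
        rw [← ((Equiv.mulLeft₀ _ hd).trans (Equiv.subLeft x)).sum_comp]
        refine Finset.sum_congr rfl fun u _ => ?_
        change quadraticChar F (x - (x - (x - y) * u)) * quadraticChar F (y - (x - (x - y) * u)) = _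
        congr 2 <;> ring
    _ = ∑ u, quadraticChar F (-1) * (quadraticChar F u * quadraticChar F (1 - u)) := by
        refine Finset.sum_congr rfl fun u _ => ?_
        rw [show y - x + (x - y) * u = (x - y) * (-1 * (1 - u)) by ring]
        simp only [map_mul]
        linear_combination quadraticChar F (-1) * quadraticChar F u * quadraticChar F (1 - u) *
          quadraticChar_sq_one hd
    _ = -1 := by
        rw [← Finset.mul_sum, hJ]
        linear_combination -quadraticChar_sq_one (neg_ne_zero.mpr (one_ne_zero (α := F)))

lemma sum_quadraticChar_mul_quadraticChar {F : Type*} [Field F] [Fintype F] [DecidableEq F]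
    (hF : ringChar F ≠ 2) (x y : F) :
    ∑ z, quadraticChar F (x - z) * quadraticChar F (y - z) =
      (Fintype.card F : ℤ) * (1 : Matrix F F ℤ) x y - 1 := by
  rcases eq_or_ne x y with rfl | hxy
  · rw [Fintype.sum_equiv (Equiv.subLeft x)
        (fun z => quadraticChar F (x - z) * quadraticChar F (x - z))
        (fun z => quadraticChar F z * quadraticChar F z) fun _ => rfl,
      ← Finset.add_sum_erase _ _ (Finset.mem_univ 0),
      Finset.sum_congr rfl fun z hz => by
        rw [← sq, quadraticChar_sq_one (Finset.ne_of_mem_erase hz)]]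
    simp [Finset.card_erase_of_mem, Nat.cast_sub Fintype.card_pos]
  · rw [sum_quadraticChar_mul_quadraticChar_of_ne hF hxy, Matrix.one_apply_ne hxy, mul_zero,
      zero_sub]

/-- The Paley type I construction: for a prime `p ≡ 3 (mod 4)`, bordering the
Paley core `Q` as `M = [[Q + I, -j], [jᵀ, 1]]` produces a Hadamard matrix of
order `p + 1`. -/
theorem paley_type_one_hadamard (p : ℕ) [Fact p.Prime] (hp : p % 4 = 3)
    (Q : Matrix (ZMod p) (ZMod p) ℤ)
    (hQ : ∀ x y, Q x y = quadraticChar (ZMod p) (x - y))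
    (M : Matrix (ZMod p ⊕ Unit) (ZMod p ⊕ Unit) ℤ)
    (hM : M = Matrix.fromBlocks (Q + 1)
      (Matrix.of fun _ _ => -1) (Matrix.of fun _ _ => 1) 1) :
    (∀ i j, M i j = 1 ∨ M i j = -1) ∧ M * Mᵀ = ((p : ℤ) + 1) • 1 := by
  have hF : ringChar (ZMod p) ≠ 2 := by
    rw [ZMod.ringChar_zmod_n]
    omega
  have hneg : quadraticChar (ZMod p) (-1) = -1 := by
    rw [quadraticChar_neg_one_iff_not_isSquare, FiniteField.isSquare_neg_one_iff, ZMod.card]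
    simpa using hp
  have hrow (x : ZMod p) : ∑ z, Q x z = 0 := by
    simp only [hQ]
    rw [Fintype.sum_equiv (Equiv.subLeft x) (fun z => quadraticChar (ZMod p) (x - z))
      (quadraticChar (ZMod p)) fun _ => rfl, quadraticChar_sum_zero hF]
  have hskew (x y : ZMod p) : Q y x = -Q x y := by
    rw [hQ, hQ, ← neg_sub, neg_eq_neg_one_mul, map_mul, hneg, neg_one_mul]
  have hcorr (x y : ZMod p) :
      ∑ z, Q x z * Q y z = (p : ℤ) * (1 : Matrix (ZMod p) (ZMod p) ℤ) x y - 1 := by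
    simp only [hQ]
    rw [sum_quadraticChar_mul_quadraticChar hF, ZMod.card]
  subst hM
  constructor
  · rintro (x | _) (y | _)
    · rcases eq_or_ne x y with rfl | hxy
      · simp [hQ]
      · simpa [hQ, Matrix.one_apply_ne hxy] using
          quadraticChar_dichotomy (sub_ne_zero.mpr hxy)
    all_goals simp
  · ext (x | _) (y | _)
    · have h1 : ∑ z, Q x z * (1 : Matrix (ZMod p) (ZMod p) ℤ) y z = Q x y := by
        simp [Matrix.one_apply]
      have h2 : ∑ z, (1 : Matrix (ZMod p) (ZMod p) ℤ) x z * Q y z = Q y x := by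
        simp [Matrix.one_apply]
      have h3 : ∑ z, (1 : Matrix (ZMod p) (ZMod p) ℤ) x z * (1 : Matrix (ZMod p) (ZMod p) ℤ) y z =
          (1 : Matrix (ZMod p) (ZMod p) ℤ) x y := by
        simp [Matrix.one_apply]
      have h4 : (1 : Matrix (ZMod p ⊕ Unit) (ZMod p ⊕ Unit) ℤ) (.inl x) (.inl y) =
          (1 : Matrix (ZMod p) (ZMod p) ℤ) x y := by
        simp [Matrix.one_apply]
      simp only [Matrix.mul_apply, Fintype.sum_sum_type, Matrix.transpose_apply,
        Matrix.fromBlocks_apply₁₁, Matrix.fromBlocks_apply₁₂, Matrix.add_apply, Matrix.of_apply,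
        Matrix.smul_apply, add_mul, mul_add, Finset.sum_add_distrib, hcorr, h1, h2, h3, h4,
        hskew x y, smul_eq_mul, Finset.univ_unique, Finset.sum_singleton]
      ring
    · simp [Matrix.mul_apply, Finset.sum_add_distrib, hrow, Matrix.one_apply]
    · simp [Matrix.mul_apply, Finset.sum_add_distrib, hrow, Matrix.one_apply]
    · simp [Matrix.mul_apply]
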